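/- arXiv:1901.00119 — 2 statements merged into one kernel-verified Lean document; each statement's English description precedes it below -/
import Mathlib

section
/- Let q ∈ L¹([0,π], ℂ), and let y₂(x,λ) = Σ_{p≥0} S_p(x,λ) and y₂'(x,λ) = Σ_{p≥0} C_p(x,λ) be the standard iterated-integral series for the solution of −y'' + q y = λ y with y(0) = 0, y'(0) = 1, where S₀ = sin(√λ x)/√λ, C₀ = cos(√λ x), S_p(x,λ) = ∫₀ˣ s_λ(x−t) q(t) S_{p−1}(t,λ) dt, C_p(x,λ) = ∫₀ˣ cos(√λ(x−t)) q(t) S_{p−1}(t,λ) dt. Then with Q(x) := ∫₀ˣ q(t) dt, as |λ| → ∞: y₂(x,λ) = sin(√λ x)/√λ − Q(x)·cos(√λ x)/(2λ) + o(exp(|Im √λ| x)/|λ|) and y₂'(x,λ) = cos(√λ x) + Q(x)·sin(√λ x)/(2√λ) + o(exp(|Im √λ| x)/|√λ|), uniformly for x ∈ [0,π]. -/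
open Complex intervalIntegral

namespace Stmt12Aux

lemma norm_exp_le (w : ℂ) (x t : ℝ) (ht0 : 0 ≤ t) (htx : t ≤ x) :
    ‖Complex.exp (I * w * ((x : ℂ) - 2 * t))‖ ≤ Real.exp (|w.im| * x) := by
  rw [Complex.norm_exp]
  apply Real.exp_le_exp.mpr
  have h : (I * w * ((x : ℂ) - 2 * t)).re = - w.im * (x - 2 * t) := by
    simp [Complex.mul_re, Complex.mul_im]
  rw [h]
  calc - w.im * (x - 2 * t) ≤ |(- w.im) * (x - 2 * t)| := le_abs_self _
    _ = |w.im| * |x - 2 * t| := by rw [abs_mul, abs_neg]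
    _ ≤ |w.im| * x := by
      apply mul_le_mul_of_nonneg_left _ (abs_nonneg _)
      rw [abs_le]; constructor <;> linarith

lemma norm_exp_half (z : ℂ) : ‖Complex.exp (z * I)‖ ≤ Real.exp |z.im| := by
  rw [Complex.norm_exp]
  apply Real.exp_le_exp.mpr
  simpa using neg_le_abs z.im

lemma norm_cos_le (w : ℂ) (u : ℝ) (hu : 0 ≤ u) :
    ‖Complex.cos (w * u)‖ ≤ Real.exp (|w.im| * u) := by
  have h1 := norm_exp_half (w * u)
  have h2 := norm_exp_half (-(w * u))
  have h3 : |(w * u).im| = |w.im| * u := by simp [abs_mul, abs_of_nonneg hu]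
  rw [neg_im, abs_neg] at h2
  rw [h3] at h1 h2
  rw [Complex.cos, norm_div]
  have := norm_add_le (Complex.exp (w * u * I)) (Complex.exp (-(w * u) * I))
  simp only [RCLike.norm_ofNat]
  linarith

lemma norm_sin_le (w : ℂ) (u : ℝ) (hu : 0 ≤ u) :
    ‖Complex.sin (w * u)‖ ≤ Real.exp (|w.im| * u) := by
  have h1 := norm_exp_half (w * u)
  have h2 := norm_exp_half (-(w * u))
  have h3 : |(w * u).im| = |w.im| * u := by simp [abs_mul, abs_of_nonneg hu]
  rw [neg_im, abs_neg] at h2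
  rw [h3] at h1 h2
  rw [Complex.sin, norm_div, norm_mul, Complex.norm_I]
  have := norm_sub_le (Complex.exp (-(w * u) * I)) (Complex.exp (w * u * I))
  simp only [RCLike.norm_ofNat]
  linarith

lemma osc_smooth (g : ℝ → ℂ) (hg : ContDiff ℝ 1 g) :
    ∃ M : ℝ, 0 ≤ M ∧ ∀ w : ℂ, w ≠ 0 → ∀ x ∈ Set.Icc (0:ℝ) Real.pi,
      ‖∫ t in (0:ℝ)..x, g t * Complex.exp (I * w * ((x : ℂ) - 2 * t))‖
        ≤ M * Real.exp (|w.im| * x) / ‖w‖ := by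
  have hd : Continuous (deriv g) := hg.continuous_deriv le_rfl
  obtain ⟨A, hA⟩ := (isCompact_Icc (a := (0:ℝ)) (b := Real.pi)).exists_bound_of_continuousOn
    hg.continuous.continuousOn
  obtain ⟨B, hB⟩ := (isCompact_Icc (a := (0:ℝ)) (b := Real.pi)).exists_bound_of_continuousOn
    hd.continuousOn
  have h0 : (0:ℝ) ∈ Set.Icc (0:ℝ) Real.pi := ⟨le_rfl, Real.pi_pos.le⟩
  have hA0 : 0 ≤ A := (norm_nonneg _).trans (hA 0 h0)
  have hB0 : 0 ≤ B := (norm_nonneg _).trans (hB 0 h0)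
  refine ⟨A + A + B * Real.pi, by positivity, ?_⟩
  intro w hw x hx
  set E := Real.exp (|w.im| * x) with hE
  have hwn : 0 < ‖w‖ := norm_pos_iff.mpr hw
  set v : ℝ → ℂ := fun t => Complex.exp (I * w * ((x : ℂ) - 2 * t)) / (-2 * I * w) with hv
  have hc : (-2 * I * w) ≠ 0 := by simp [hw]
  have hv' : ∀ t : ℝ, HasDerivAt v (Complex.exp (I * w * ((x : ℂ) - 2 * t))) t := by
    intro t
    have h1 : HasDerivAt (fun t : ℝ => (t : ℂ)) 1 t := Complex.ofRealCLM.hasDerivAt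
    have h2 := ((((h1.const_mul 2).const_sub (x : ℂ)).const_mul (I * w)).cexp).div_const
      (-2 * I * w)
    have h3 : Complex.exp (I * w * ((x : ℂ) - 2 * t)) * (I * w * -(2 * 1)) / (-2 * I * w)
        = Complex.exp (I * w * ((x : ℂ) - 2 * t)) := by
      rw [div_eq_iff hc]; ring
    rw [h3] at h2
    exact h2
  have hcont : Continuous (fun t : ℝ => Complex.exp (I * w * ((x : ℂ) - 2 * t))) := by fun_prop
  have key := integral_mul_deriv_eq_deriv_mul (a := 0) (b := x) (u := g) (v := v) (u' := deriv g)
    (v' := fun t => Complex.exp (I * w * ((x : ℂ) - 2 * t)))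
    (fun t _ => (hg.differentiable (by simp) t).hasDerivAt) (fun t _ => hv' t)
    (hd.intervalIntegrable _ _) (hcont.intervalIntegrable _ _)
  rw [key]
  have hvb : ∀ t, 0 ≤ t → t ≤ x → ‖v t‖ ≤ E / ‖w‖ := by
    intro t h1 h2
    have := norm_exp_le w x t h1 h2
    simp only [hv, norm_div, norm_mul, norm_neg, Complex.norm_I, RCLike.norm_ofNat]
    have hE0 : 0 < E := Real.exp_pos _
    rw [div_le_div_iff₀ (by positivity) hwn]
    nlinarith [mul_le_mul_of_nonneg_right this hwn.le, mul_pos hE0 hwn]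
  have hEw : 0 ≤ E / ‖w‖ := by positivity
  have i1 : ‖g x * v x‖ ≤ A * (E / ‖w‖) := by
    rw [norm_mul]; exact mul_le_mul (hA x hx) (hvb x hx.1 le_rfl) (norm_nonneg _) hA0
  have i2 : ‖g 0 * v 0‖ ≤ A * (E / ‖w‖) := by
    rw [norm_mul]; exact mul_le_mul (hA 0 h0) (hvb 0 le_rfl hx.1) (norm_nonneg _) hA0
  have i3 : ‖∫ t in (0:ℝ)..x, deriv g t * v t‖ ≤ B * (E / ‖w‖) * |x - 0| := by
    apply norm_integral_le_of_norm_le_const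
    intro t ht
    rw [Set.uIoc_of_le hx.1] at ht
    rw [norm_mul]
    exact mul_le_mul (hB t ⟨ht.1.le, ht.2.trans hx.2⟩) (hvb t ht.1.le ht.2) (norm_nonneg _) hB0
  have i4 : B * (E / ‖w‖) * |x - 0| ≤ B * (E / ‖w‖) * Real.pi := by
    rw [sub_zero, abs_of_nonneg hx.1]
    exact mul_le_mul_of_nonneg_left hx.2 (by positivity)
  calc _ ≤ ‖g x * v x‖ + ‖g 0 * v 0‖ + ‖∫ t in (0:ℝ)..x, deriv g t * v t‖ :=
        (norm_sub_le _ _).trans (add_le_add_left (norm_sub_le _ _) _)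
    _ ≤ A * (E / ‖w‖) + A * (E / ‖w‖) + B * (E / ‖w‖) * Real.pi := by linarith
    _ = _ := by ring

lemma ii (q : ℝ → ℂ) (hq : MeasureTheory.IntegrableOn q (Set.Icc 0 Real.pi))
    (x : ℝ) (hx : x ∈ Set.Icc (0:ℝ) Real.pi) :
    IntervalIntegrable q MeasureTheory.volume 0 x := by
  rw [intervalIntegrable_iff_integrableOn_Icc_of_le hx.1]
  exact hq.mono_set (Set.Icc_subset_Icc le_rfl hx.2)

lemma int_norm_le (q : ℝ → ℂ) (hq : MeasureTheory.IntegrableOn q (Set.Icc 0 Real.pi))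
    (x : ℝ) (hx : x ∈ Set.Icc (0:ℝ) Real.pi) :
    ∫ t in (0:ℝ)..x, ‖q t‖ ≤ ∫ t in Set.Icc 0 Real.pi, ‖q t‖ := by
  rw [integral_of_le hx.1]
  apply MeasureTheory.setIntegral_mono_set hq.norm
  · exact Filter.Eventually.of_forall fun _ => norm_nonneg _
  · exact (Set.Ioc_subset_Icc_self.trans (Set.Icc_subset_Icc le_rfl hx.2)).eventuallyLE

lemma osc (q : ℝ → ℂ) (hq : MeasureTheory.IntegrableOn q (Set.Icc 0 Real.pi)) :
    ∀ ε > (0:ℝ), ∃ R : ℝ, 0 < R ∧ ∀ w : ℂ, R ≤ ‖w‖ → ∀ x ∈ Set.Icc (0:ℝ) Real.pi,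
      ‖∫ t in (0:ℝ)..x, q t * Complex.exp (I * w * ((x : ℂ) - 2 * t))‖
        ≤ ε * Real.exp (|w.im| * x) := by
  intro ε hε
  have hm : MeasureTheory.MemLp q 1 (MeasureTheory.volume.restrict (Set.Icc 0 Real.pi)) :=
    MeasureTheory.memLp_one_iff_integrable.mpr hq
  obtain ⟨g, -, hg, hqg⟩ := hm.exist_eLpNorm_sub_le (by simp) le_rfl (ε := ε / 2) (by positivity)
  have hg1 : ContDiff ℝ 1 g := hg.of_le (by exact_mod_cast le_top)
  obtain ⟨M, hM0, hM⟩ := osc_smooth g hg1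
  have hgi : MeasureTheory.IntegrableOn g (Set.Icc 0 Real.pi) :=
    hg1.continuous.continuousOn.integrableOn_Icc
  have hdi : MeasureTheory.IntegrableOn (fun t => q t - g t) (Set.Icc 0 Real.pi) := hq.sub hgi
  have hd : ∫ t in Set.Icc 0 Real.pi, ‖q t - g t‖ ≤ ε / 2 := by
    rw [MeasureTheory.integral_norm_eq_lintegral_enorm hdi.1]
    apply ENNReal.toReal_le_of_le_ofReal (by positivity)
    rw [MeasureTheory.eLpNorm_one_eq_lintegral_enorm] at hqg
    exact hqg
  refine ⟨2 * M / ε + 1, by positivity, ?_⟩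
  intro w hw x hx
  have hwn : 0 < ‖w‖ := lt_of_lt_of_le (by positivity) hw
  have hw0 : w ≠ 0 := norm_pos_iff.mp hwn
  have h1 := hM w hw0 x hx
  set E := Real.exp (|w.im| * x) with hE
  have hE0 : 0 < E := Real.exp_pos _
  have hcont : Continuous (fun t : ℝ => Complex.exp (I * w * ((x : ℂ) - 2 * t))) := by fun_prop
  have h2 : ‖∫ t in (0:ℝ)..x, (q t - g t) * Complex.exp (I * w * ((x : ℂ) - 2 * t))‖
      ≤ ε / 2 * E := by
    calc _ ≤ ∫ t in (0:ℝ)..x, ‖q t - g t‖ * E := by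
          apply norm_integral_le_of_norm_le hx.1
          · refine Filter.Eventually.of_forall fun t ht => ?_
            rw [norm_mul]
            exact mul_le_mul_of_nonneg_left (norm_exp_le w x t ht.1.le ht.2) (norm_nonneg _)
          · exact (ii _ hdi x hx).norm.mul_const _
      _ = (∫ t in (0:ℝ)..x, ‖q t - g t‖) * E := integral_mul_const _ _
      _ ≤ ε / 2 * E := mul_le_mul_of_nonneg_right ((int_norm_le _ hdi x hx).trans hd) hE0.le
  have h3 : ∫ t in (0:ℝ)..x, q t * Complex.exp (I * w * ((x : ℂ) - 2 * t))
      = (∫ t in (0:ℝ)..x, (q t - g t) * Complex.exp (I * w * ((x : ℂ) - 2 * t)))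
        + ∫ t in (0:ℝ)..x, g t * Complex.exp (I * w * ((x : ℂ) - 2 * t)) := by
    rw [← integral_add]
    · congr 1; ext t; ring
    · exact (ii _ hdi x hx).mul_continuousOn hcont.continuousOn
    · exact (ii _ hgi x hx).mul_continuousOn hcont.continuousOn
  rw [h3]
  have h4 : M * E / ‖w‖ ≤ ε / 2 * E := by
    rw [div_le_iff₀ hwn]
    have : 2 * M / ε ≤ ‖w‖ := by linarith
    rw [div_le_iff₀ hε] at this
    nlinarith
  calc _ ≤ _ := norm_add_le _ _
    _ ≤ ε / 2 * E + ε / 2 * E := add_le_add h2 (h1.trans h4)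
    _ = _ := by ring

lemma int_bound (q : ℝ → ℂ) (hq : MeasureTheory.IntegrableOn q (Set.Icc 0 Real.pi))
    (w : ℂ) (x : ℝ) (hx : x ∈ Set.Icc (0:ℝ) Real.pi) (a b : ℝ) (hb : 0 ≤ b) (ha : 0 ≤ a)
    (k s : ℝ → ℂ)
    (hk : ∀ t, 0 ≤ t → t ≤ x → ‖k t‖ ≤ a * Real.exp (|w.im| * (x - t)))
    (hs : ∀ t, 0 ≤ t → t ≤ x → ‖s t‖ ≤ b * Real.exp (|w.im| * t)) :
    ‖∫ t in (0:ℝ)..x, k t * q t * s t‖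
      ≤ a * b * (∫ t in Set.Icc 0 Real.pi, ‖q t‖) * Real.exp (|w.im| * x) := by
  calc _ ≤ ∫ t in (0:ℝ)..x, ‖q t‖ * (a * b * Real.exp (|w.im| * x)) := by
        apply norm_integral_le_of_norm_le hx.1
        · refine Filter.Eventually.of_forall fun t ht => ?_
          rw [norm_mul, norm_mul]
          have e : Real.exp (|w.im| * x) = Real.exp (|w.im| * (x - t)) * Real.exp (|w.im| * t) := by
            rw [← Real.exp_add]; congr 1; ring
          rw [e]
          calc ‖k t‖ * ‖q t‖ * ‖s t‖ = ‖q t‖ * (‖k t‖ * ‖s t‖) := by ring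
            _ ≤ ‖q t‖ * ((a * Real.exp (|w.im| * (x - t))) * (b * Real.exp (|w.im| * t))) := by
              apply mul_le_mul_of_nonneg_left _ (norm_nonneg _)
              exact mul_le_mul (hk t ht.1.le ht.2) (hs t ht.1.le ht.2) (norm_nonneg _)
                (by positivity)
            _ = _ := by ring
        · exact (ii _ hq x hx).norm.mul_const _
    _ = (∫ t in (0:ℝ)..x, ‖q t‖) * (a * b * Real.exp (|w.im| * x)) := integral_mul_const _ _
    _ ≤ (∫ t in Set.Icc 0 Real.pi, ‖q t‖) * (a * b * Real.exp (|w.im| * x)) :=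
      mul_le_mul_of_nonneg_right (int_norm_le _ hq x hx) (by positivity)
    _ = _ := by ring

lemma split_int (q : ℝ → ℂ) (hq : MeasureTheory.IntegrableOn q (Set.Icc 0 Real.pi))
    (w : ℂ) (x : ℝ) (hx : x ∈ Set.Icc (0:ℝ) Real.pi) (a b c : ℂ) :
    ∫ t in (0:ℝ)..x, (a * (q t * Complex.exp (I * w * ((x : ℂ) - 2 * t)))
        + b * (q t * Complex.exp (I * (-w) * ((x : ℂ) - 2 * t))) + c * q t)
      = a * (∫ t in (0:ℝ)..x, q t * Complex.exp (I * w * ((x : ℂ) - 2 * t)))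
        + b * (∫ t in (0:ℝ)..x, q t * Complex.exp (I * (-w) * ((x : ℂ) - 2 * t)))
        + c * ∫ t in (0:ℝ)..x, q t := by
  have hcont : ∀ w : ℂ, Continuous (fun t : ℝ => Complex.exp (I * w * ((x : ℂ) - 2 * t))) := by
    intro w; fun_prop
  have h := ii q hq x hx
  have h1 := (h.mul_continuousOn (hcont w).continuousOn).const_mul a
  have h2 := (h.mul_continuousOn (hcont (-w)).continuousOn).const_mul b
  rw [integral_add (h1.add h2) (h.const_mul c), integral_add h1 h2]
  simp only [integral_const_mul]

lemma tail_bound (f : ℕ → ℂ) (D r : ℝ) (hr0 : 0 ≤ r) (hr : r ≤ 1 / 2) (hD : 0 ≤ D)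
    (hf : ∀ p, ‖f p‖ ≤ D * r ^ p) :
    ‖(∑' p, f p) - (f 0 + f 1)‖ ≤ 2 * D * r ^ 2 := by
  have hg : HasSum (fun p : ℕ => D * r ^ p) (D * (1 - r)⁻¹) :=
    (hasSum_geometric_of_lt_one hr0 (by linarith)).mul_left D
  have hs : Summable f := Summable.of_norm_bounded hg.summable hf
  have h := hs.sum_add_tsum_nat_add 2
  rw [← h, Finset.sum_range_succ, Finset.sum_range_one, add_sub_cancel_left]
  have hg2 : HasSum (fun p : ℕ => D * r ^ 2 * r ^ p) (D * r ^ 2 * (1 - r)⁻¹) :=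
    (hasSum_geometric_of_lt_one hr0 (by linarith)).mul_left _
  have := tsum_of_norm_bounded (f := fun p => f (p + 2)) hg2 (fun p => by
    refine (hf (p + 2)).trans (le_of_eq ?_); ring)
  refine this.trans ?_
  have h2 : (1 - r)⁻¹ ≤ 2 := by
    rw [inv_le_comm₀ (by linarith) (by norm_num)]; linarith
  have : D * r ^ 2 * (1 - r)⁻¹ ≤ D * r ^ 2 * 2 := mul_le_mul_of_nonneg_left h2 (by positivity)
  linarith

lemma cos_id (w x t : ℂ) : Complex.exp (I * w * (x - 2 * t)) + Complex.exp (I * (-w) * (x - 2 * t))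
    = 2 * Complex.cos (w * (x - t) - w * t) := by
  rw [Complex.two_cos]
  congr 1 <;> congr 1 <;> ring

lemma sin_id (w x t : ℂ) : Complex.exp (I * w * (x - 2 * t)) - Complex.exp (I * (-w) * (x - 2 * t))
    = 2 * I * Complex.sin (w * (x - t) - w * t) := by
  have h := Complex.two_sin (w * (x - t) - w * t)
  rw [mul_right_comm 2 I, h, mul_assoc _ I I, I_mul_I]
  have e1 : I * w * (x - 2 * t) = (w * (x - t) - w * t) * I := by ring
  have e2 : I * (-w) * (x - 2 * t) = -(w * (x - t) - w * t) * I := by ring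
  rw [e1, e2]; ring

end Stmt12Aux

/-- With `q ∈ L¹[0,π]` and the standard series
`y₂(x,λ) = Σₚ Sₚ(x,λ)`, `y₂'(x,λ) = Σₚ Cₚ(x,λ)` for the solution of
`−y'' + q y = λ y`, `y(0)=0`, `y'(0)=1`, one has, with `Q(x) = ∫₀ˣ q`,
`y₂(x,λ) = sin(√λ x)/√λ − Q(x) cos(√λ x)/(2λ) + o(exp(|Im √λ| x)/|λ|)` and
`y₂'(x,λ) = cos(√λ x) + Q(x) sin(√λ x)/(2√λ) + o(exp(|Im √λ| x)/|√λ|)`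
as `|λ| → ∞`, uniformly for `x ∈ [0,π]` (here `w = √λ`, `λ = w²`). -/
theorem stmt12 (q : ℝ → ℂ)
    (hq : MeasureTheory.IntegrableOn q (Set.Icc 0 Real.pi))
    (S Cf : ℕ → ℝ → ℂ → ℂ)
    (hS0 : ∀ x : ℝ, ∀ w : ℂ, w ≠ 0 → S 0 x w = Complex.sin (w * (x : ℂ)) / w)
    (hC0 : ∀ x : ℝ, ∀ w : ℂ, w ≠ 0 → Cf 0 x w = Complex.cos (w * (x : ℂ)))
    (hSp : ∀ p : ℕ, ∀ x : ℝ, ∀ w : ℂ, w ≠ 0 →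
      S (p + 1) x w
        = ∫ t in (0:ℝ)..x, (Complex.sin (w * ((x : ℂ) - t)) / w) * q t * S p t w)
    (hCp : ∀ p : ℕ, ∀ x : ℝ, ∀ w : ℂ, w ≠ 0 →
      Cf (p + 1) x w
        = ∫ t in (0:ℝ)..x, Complex.cos (w * ((x : ℂ) - t)) * q t * S p t w) :
    ∀ ε > (0:ℝ), ∃ R : ℝ, ∀ w : ℂ, R ≤ ‖w‖ → ∀ x ∈ Set.Icc (0:ℝ) Real.pi,
      ‖(∑' p : ℕ, S p x w)
          - (Complex.sin (w * (x : ℂ)) / w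
            - (∫ t in (0:ℝ)..x, q t) * Complex.cos (w * (x : ℂ)) / (2 * w ^ 2))‖
        ≤ ε * Real.exp (|w.im| * x) / ‖w‖ ^ 2 ∧
      ‖(∑' p : ℕ, Cf p x w)
          - (Complex.cos (w * (x : ℂ))
            + (∫ t in (0:ℝ)..x, q t) * Complex.sin (w * (x : ℂ)) / (2 * w))‖
        ≤ ε * Real.exp (|w.im| * x) / ‖w‖ := by
  intro ε hε
  obtain ⟨R1, hR1, hosc⟩ := Stmt12Aux.osc q hq ε hε
  set K : ℝ := ∫ t in Set.Icc 0 Real.pi, ‖q t‖ with hK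
  have hK0 : 0 ≤ K := MeasureTheory.integral_nonneg fun _ => norm_nonneg _
  refine ⟨R1 + 2 * K + 4 * K ^ 2 / ε, ?_⟩
  intro w hw x hx
  have hq4 : 0 ≤ 4 * K ^ 2 / ε := by positivity
  have hwR : R1 ≤ ‖w‖ := by linarith
  have hwK : 2 * K ≤ ‖w‖ := by linarith
  have hwe : 4 * K ^ 2 ≤ ‖w‖ * ε := by
    rw [← div_le_iff₀ hε]; linarith
  have hwn : 0 < ‖w‖ := lt_of_lt_of_le hR1 hwR
  have hw0 : w ≠ 0 := norm_pos_iff.mp hwn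
  set r : ℝ := K / ‖w‖ with hr
  have hr0 : 0 ≤ r := by positivity
  have hr2 : r ≤ 1 / 2 := by rw [hr, div_le_iff₀ hwn]; linarith
  have hsin : ∀ x t : ℝ, 0 ≤ t → t ≤ x →
      ‖Complex.sin (w * ((x : ℂ) - t)) / w‖ ≤ 1 / ‖w‖ * Real.exp (|w.im| * (x - t)) := by
    intro x t _ h
    have := Stmt12Aux.norm_sin_le w (x - t) (by linarith)
    rw [Complex.ofReal_sub] at this
    rw [norm_div, div_eq_mul_inv, mul_comm, one_div]
    exact mul_le_mul_of_nonneg_left this (by positivity)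
  have hcos : ∀ x t : ℝ, 0 ≤ t → t ≤ x →
      ‖Complex.cos (w * ((x : ℂ) - t))‖ ≤ 1 * Real.exp (|w.im| * (x - t)) := by
    intro x t _ h
    have := Stmt12Aux.norm_cos_le w (x - t) (by linarith)
    rw [Complex.ofReal_sub] at this
    linarith
  have hSb : ∀ p : ℕ, ∀ y ∈ Set.Icc (0:ℝ) Real.pi,
      ‖S p y w‖ ≤ r ^ p / ‖w‖ * Real.exp (|w.im| * y) := by
    intro p
    induction p with
    | zero =>
      intro y hy
      have := hsin y 0 le_rfl hy.1
      simp only [Complex.ofReal_zero, sub_zero] at this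
      rw [hS0 y w hw0, pow_zero]
      exact this
    | succ p ih =>
      intro y hy
      rw [hSp p y w hw0]
      refine (Stmt12Aux.int_bound q hq w y hy (1 / ‖w‖) (r ^ p / ‖w‖) (by positivity)
        (by positivity) _ _ (hsin y) (fun t h0 h1 => ih t ⟨h0, h1.trans hy.2⟩)).trans ?_
      apply le_of_eq
      rw [pow_succ, ← hK, hr]; ring
  set E := Real.exp (|w.im| * x) with hE
  have hE0 : 0 < E := Real.exp_pos _
  have hCb : ∀ p : ℕ, ‖Cf p x w‖ ≤ E * r ^ p := by
    intro p
    cases p with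
    | zero =>
      rw [hC0 x w hw0, pow_zero, mul_one]
      exact Stmt12Aux.norm_cos_le w x hx.1
    | succ p =>
      rw [hCp p x w hw0]
      refine (Stmt12Aux.int_bound q hq w x hx 1 (r ^ p / ‖w‖) (by positivity)
        (by positivity) _ _ (hcos x) (fun t h0 h1 => hSb p t ⟨h0, h1.trans hx.2⟩)).trans ?_
      apply le_of_eq
      rw [pow_succ, ← hK, hr]; ring
  have tS := Stmt12Aux.tail_bound (fun p => S p x w) (E / ‖w‖) r hr0 hr2 (by positivity)
    (fun p => (hSb p x hx).trans (le_of_eq (by ring)))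
  have tC := Stmt12Aux.tail_bound (fun p => Cf p x w) E r hr0 hr2 hE0.le hCb
  have hI1 := hosc w hwR x hx
  have hI2 := hosc (-w) (by rwa [norm_neg]) x hx
  rw [neg_im, abs_neg] at hI2
  rw [← hE] at hI1 hI2
  set I1 := ∫ t in (0:ℝ)..x, q t * Complex.exp (I * w * ((x : ℂ) - 2 * t)) with hI1d
  set I2 := ∫ t in (0:ℝ)..x, q t * Complex.exp (I * (-w) * ((x : ℂ) - 2 * t)) with hI2d
  set Q := ∫ t in (0:ℝ)..x, q t with hQ
  have hxt : ∀ t : ℝ, w * (x : ℂ) = w * ((x : ℂ) - t) + w * t := by intro t; ring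
  have hS1 : S 1 x w = 1 / (4 * w ^ 2) * I1 + 1 / (4 * w ^ 2) * I2
      + (-Complex.cos (w * x) / (2 * w ^ 2)) * Q := by
    rw [hSp 0 x w hw0, hI1d, hI2d, hQ, ← Stmt12Aux.split_int q hq w x hx]
    apply integral_congr
    intro t _
    have e := Stmt12Aux.cos_id w x t
    have e2 : Complex.exp (I * w * ((x : ℂ) - 2 * t)) =
        2 * Complex.cos (w * (x - t) - w * t) - Complex.exp (I * (-w) * ((x : ℂ) - 2 * t)) := by
      rw [← e]; ring
    simp only [hS0 t w hw0, e2]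
    rw [hxt t, Complex.cos_add, Complex.cos_sub]
    field_simp
    ring
  have hC1 : Cf 1 x w = (-1 / (4 * I * w)) * I1 + 1 / (4 * I * w) * I2
      + (Complex.sin (w * x) / (2 * w)) * Q := by
    rw [hCp 0 x w hw0, hI1d, hI2d, hQ, ← Stmt12Aux.split_int q hq w x hx]
    apply integral_congr
    intro t _
    have e := Stmt12Aux.sin_id w x t
    have e2 : Complex.exp (I * w * ((x : ℂ) - 2 * t)) =
        2 * I * Complex.sin (w * (x - t) - w * t)
          + Complex.exp (I * (-w) * ((x : ℂ) - 2 * t)) := by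
      rw [← e]; ring
    simp only [hS0 t w hw0, e2]
    rw [hxt t, Complex.sin_add, Complex.sin_sub]
    have hI : (I : ℂ) ≠ 0 := Complex.I_ne_zero
    field_simp
    ring
  constructor
  · have eq : (∑' p : ℕ, S p x w) - (Complex.sin (w * (x : ℂ)) / w
            - Q * Complex.cos (w * (x : ℂ)) / (2 * w ^ 2))
        = ((∑' p : ℕ, S p x w) - (S 0 x w + S 1 x w)) + 1 / (4 * w ^ 2) * (I1 + I2) := by
      rw [hS1, hS0 x w hw0]; ring
    rw [eq]
    have n1 : ‖1 / (4 * w ^ 2) * (I1 + I2)‖ ≤ 1 / (4 * ‖w‖ ^ 2) * (ε * E + ε * E) := by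
      rw [norm_mul]
      apply mul_le_mul _ ((norm_add_le _ _).trans (add_le_add hI1 hI2)) (norm_nonneg _)
        (by positivity)
      simp
    have n2 : 2 * (E / ‖w‖) * r ^ 2 ≤ ε * E / (2 * ‖w‖ ^ 2) := by
      rw [hr, show 2 * (E / ‖w‖) * (K / ‖w‖) ^ 2 = (4 * K ^ 2) * (E / (2 * ‖w‖ ^ 3)) by
        field_simp; ring]
      refine (mul_le_mul_of_nonneg_right hwe (by positivity)).trans (le_of_eq ?_)
      field_simp
    refine (norm_add_le _ _).trans ((add_le_add (tS.trans n2) n1).trans (le_of_eq ?_))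
    field_simp
    ring
  · have eq : (∑' p : ℕ, Cf p x w) - (Complex.cos (w * (x : ℂ))
            + Q * Complex.sin (w * (x : ℂ)) / (2 * w))
        = ((∑' p : ℕ, Cf p x w) - (Cf 0 x w + Cf 1 x w)) + 1 / (4 * I * w) * (I2 - I1) := by
      rw [hC1, hC0 x w hw0]; ring
    rw [eq]
    have n1 : ‖1 / (4 * I * w) * (I2 - I1)‖ ≤ 1 / (4 * ‖w‖) * (ε * E + ε * E) := by
      rw [norm_mul]
      apply mul_le_mul _ ((norm_sub_le _ _).trans (add_le_add hI2 hI1)) (norm_nonneg _)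
        (by positivity)
      simp
    have n2 : 2 * E * r ^ 2 ≤ ε * E / (2 * ‖w‖) := by
      rw [hr, show 2 * E * (K / ‖w‖) ^ 2 = (4 * K ^ 2) * (E / (2 * ‖w‖ ^ 2)) by
        field_simp; ring]
      refine (mul_le_mul_of_nonneg_right hwe (by positivity)).trans (le_of_eq ?_)
      field_simp
    refine (norm_add_le _ _).trans ((add_le_add (tC.trans n2) n1).trans (le_of_eq ?_))
    field_simp
    ring
end

section
/- Let q, q̃ ∈ L¹([0,π], ℂ), r ∈ [0,π), x₀ ∈ (r,π], and let y_{2,r}(·,λ), ỹ_{2,r}(·,λ) be the solutions of −y'' + q y = λ y and −y'' + q̃ y = λ y respectively with y(r) = 0, y'(r) = 1. Then as |λ| → ∞, y_{2,r}(x₀,λ)·ỹ_{2,r}'(x₀,λ) − y_{2,r}'(x₀,λ)·ỹ_{2,r}(x₀,λ) = (1/(2λ))·∫_r^{x₀}(q̃(t) − q(t)) dt + o(exp(2|Im √λ|(x₀−r))/|λ|). -/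
open Complex intervalIntegral

lemma norm_sin_le_aux (z : ℂ) : ‖Complex.sin z‖ ≤ Real.exp |z.im| := by
  have h1 : ‖Complex.exp (-z * I)‖ ≤ Real.exp |z.im| := by
    rw [Complex.norm_exp]; apply Real.exp_le_exp.2; simpa using le_abs_self z.im
  have h2 : ‖Complex.exp (z * I)‖ ≤ Real.exp |z.im| := by
    rw [Complex.norm_exp]; apply Real.exp_le_exp.2; simpa using neg_le_abs z.im
  rw [Complex.sin, norm_div, norm_mul, Complex.norm_I, mul_one]
  have := norm_sub_le (Complex.exp (-z * I)) (Complex.exp (z * I))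
  rw [show ‖(2:ℂ)‖ = 2 by simp]
  linarith

lemma norm_cos_le_aux (z : ℂ) : ‖Complex.cos z‖ ≤ Real.exp |z.im| := by
  have h1 : ‖Complex.exp (-z * I)‖ ≤ Real.exp |z.im| := by
    rw [Complex.norm_exp]; apply Real.exp_le_exp.2; simpa using le_abs_self z.im
  have h2 : ‖Complex.exp (z * I)‖ ≤ Real.exp |z.im| := by
    rw [Complex.norm_exp]; apply Real.exp_le_exp.2; simpa using neg_le_abs z.im
  rw [Complex.cos, norm_div]
  have := norm_add_le (Complex.exp (z * I)) (Complex.exp (-z * I))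
  rw [show ‖(2:ℂ)‖ = 2 by simp]
  linarith

/-- Smooth functions are dense in `L¹` of an interval. -/
lemma approx_aux {a b : ℝ} (hab : a ≤ b) {g : ℝ → ℂ}
    (hg : IntervalIntegrable g MeasureTheory.volume a b) {δ : ℝ} (hδ : 0 < δ) :
    ∃ h : ℝ → ℂ, ContDiff ℝ 1 h ∧ ∫ t in a..b, ‖g t - h t‖ ≤ δ := by
  have hg' := (intervalIntegrable_iff_integrableOn_Ioc_of_le hab).1 hg
  have hm : MeasureTheory.MemLp g 1 (MeasureTheory.volume.restrict (Set.Ioc a b)) :=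
    MeasureTheory.memLp_one_iff_integrable.2 hg'
  obtain ⟨h, -, h2, h3⟩ := hm.exist_eLpNorm_sub_le (by simp) le_rfl hδ
  refine ⟨h, h2.of_le (by exact_mod_cast le_top), ?_⟩
  rw [intervalIntegral.integral_of_le hab]
  have hh : MeasureTheory.IntegrableOn h (Set.Ioc a b) :=
    (h2.continuous.continuousOn.integrableOn_Icc).mono_set Set.Ioc_subset_Icc_self
  have hi : MeasureTheory.Integrable (g - h) (MeasureTheory.volume.restrict (Set.Ioc a b)) :=
    hg'.sub hh
  rw [MeasureTheory.eLpNorm_one_eq_lintegral_enorm] at h3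
  have := MeasureTheory.integral_norm_eq_lintegral_enorm hi.aestronglyMeasurable
  simp only [Pi.sub_apply] at this
  rw [this]
  exact ENNReal.toReal_le_of_le_ofReal hδ.le h3

/-- Bound of an integral by a bounded factor times an integrable factor. -/
lemma bound_aux {a b : ℝ} (hab : a ≤ b) {u g : ℝ → ℂ} {M : ℝ}
    (hu : ∀ t ∈ Set.Icc a b, ‖u t‖ ≤ M)
    (hg : IntervalIntegrable g MeasureTheory.volume a b) :
    ‖∫ t in a..b, u t * g t‖ ≤ M * ∫ t in a..b, ‖g t‖ := by
  rw [← intervalIntegral.integral_const_mul]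
  refine intervalIntegral.norm_integral_le_of_norm_le hab ?_ (hg.norm.const_mul M)
  refine Filter.Eventually.of_forall fun t ht => ?_
  rw [norm_mul]
  exact mul_le_mul_of_nonneg_right (hu t (Set.Ioc_subset_Icc_self ht)) (norm_nonneg _)

lemma ibp_aux {a b : ℝ} (hab : a ≤ b) {u u' g v : ℝ → ℂ} (c : ℂ)
    (hu : ∀ t ∈ Set.Icc a b, HasDerivAt u (u' t) t)
    (hu' : ContinuousOn u' (Set.Icc a b))
    (hg : IntervalIntegrable g MeasureTheory.volume a b)
    (hv : ∀ x ∈ Set.Icc a b, v x = c + ∫ t in a..x, g t) :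
    ∫ t in a..b, u t * g t = u b * v b - u a * v a - ∫ t in a..b, u' t * v t := by
  have hucont : ContinuousOn u (Set.Icc a b) :=
    fun t ht => (hu t ht).continuousAt.continuousWithinAt
  obtain ⟨M, hM⟩ := isCompact_Icc.exists_bound_of_continuousOn hucont
  obtain ⟨M', hM'⟩ := isCompact_Icc.exists_bound_of_continuousOn hu'
  have hM0 : 0 ≤ M := (norm_nonneg _).trans (hM a ⟨le_rfl, hab⟩)
  have hM'0 : 0 ≤ M' := (norm_nonneg _).trans (hM' a ⟨le_rfl, hab⟩)
  have hvcont : ContinuousOn v (Set.Icc a b) := by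
    have : ContinuousOn (fun x => c + ∫ t in a..x, g t) (Set.Icc a b) := by
      refine continuousOn_const.add ?_
      have := intervalIntegral.continuousOn_primitive_interval' hg (a := a) (by simp)
      rwa [Set.uIcc_of_le hab] at this
    exact this.congr hv
  have key : ∀ δ > 0, ‖(∫ t in a..b, u t * g t) -
      (u b * v b - u a * v a - ∫ t in a..b, u' t * v t)‖ ≤ (2 * M + M' * (b - a)) * δ := by
    intro δ hδ
    obtain ⟨h, hh, hgh⟩ := approx_aux hab hg hδ
    have hhc := hh.continuous
    have hhi : ∀ x y, IntervalIntegrable h MeasureTheory.volume x y :=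
      fun x y => hhc.intervalIntegrable x y
    set V : ℝ → ℂ := fun x => c + ∫ t in a..x, h t with hV
    have hVd : ∀ x, HasDerivAt V (h x) x := fun x =>
      (intervalIntegral.integral_hasDerivAt_right (hhi a x)
        (hhc.stronglyMeasurableAtFilter _ _) hhc.continuousAt).const_add c
    have hVc : Continuous V := continuous_iff_continuousAt.2 fun x => (hVd x).continuousAt
    have huI : Set.uIcc a b = Set.Icc a b := Set.uIcc_of_le hab
    have e1 : ∫ t in a..b, u t * h t = u b * V b - u a * V a - ∫ t in a..b, u' t * V t :=
      intervalIntegral.integral_mul_deriv_eq_deriv_mul (by rwa [huI]) (fun x _ => hVd x)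
        (ContinuousOn.intervalIntegrable (by rwa [huI])) (hhi a b)
    have hd : IntervalIntegrable (fun t => g t - h t) MeasureTheory.volume a b := hg.sub (hhi a b)
    have hVv : ∀ x ∈ Set.Icc a b, ‖v x - V x‖ ≤ δ := by
      intro x hx
      have hgx : IntervalIntegrable g MeasureTheory.volume a x :=
        hg.mono_set (by rw [huI, Set.uIcc_of_le hx.1]; exact Set.Icc_subset_Icc_right hx.2)
      have hdx : IntervalIntegrable (fun t => g t - h t) MeasureTheory.volume a x :=
        hgx.sub (hhi a x)
      have : v x - V x = ∫ t in a..x, (g t - h t) := by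
        rw [intervalIntegral.integral_sub hgx (hhi a x), hv x hx, hV]; ring
      rw [this]
      refine (intervalIntegral.norm_integral_le_integral_norm hx.1).trans (le_trans ?_ hgh)
      refine intervalIntegral.integral_mono_interval le_rfl hx.1 hx.2 ?_ hd.norm
      exact Filter.Eventually.of_forall fun t => norm_nonneg _
    have hVa : v a = V a := by rw [hv a ⟨le_rfl, hab⟩]; simp [hV]
    have i1 : IntervalIntegrable (fun t => u t * g t) MeasureTheory.volume a b :=
      hg.continuousOn_mul (by rwa [huI])
    have i2 : IntervalIntegrable (fun t => u t * h t) MeasureTheory.volume a b :=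
      (hhi a b).continuousOn_mul (by rwa [huI])
    have i3 : IntervalIntegrable (fun t => u' t * v t) MeasureTheory.volume a b :=
      ContinuousOn.intervalIntegrable (by rw [huI]; exact hu'.mul hvcont)
    have i4 : IntervalIntegrable (fun t => u' t * V t) MeasureTheory.volume a b :=
      ContinuousOn.intervalIntegrable (by rw [huI]; exact hu'.mul hVc.continuousOn)
    have e2 : (∫ t in a..b, u t * g t) - (u b * v b - u a * v a - ∫ t in a..b, u' t * v t)
        = (∫ t in a..b, u t * (g t - h t)) - u b * (v b - V b)
          + ∫ t in a..b, u' t * (v t - V t) := by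
      simp only [mul_sub]
      rw [intervalIntegral.integral_sub i1 i2, intervalIntegral.integral_sub i3 i4, e1, hVa]
      ring
    rw [e2]
    have b1 : ‖∫ t in a..b, u t * (g t - h t)‖ ≤ M * δ :=
      (bound_aux hab hM hd).trans (mul_le_mul_of_nonneg_left hgh hM0)
    have b2 : ‖u b * (v b - V b)‖ ≤ M * δ := by
      rw [norm_mul]
      exact mul_le_mul (hM b ⟨hab, le_rfl⟩) (hVv b ⟨hab, le_rfl⟩) (norm_nonneg _) hM0
    have b3 : ‖∫ t in a..b, u' t * (v t - V t)‖ ≤ (M' * δ) * |b - a| := by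
      refine intervalIntegral.norm_integral_le_of_norm_le_const fun t ht => ?_
      rw [Set.uIoc_of_le hab] at ht
      have ht := Set.Ioc_subset_Icc_self ht
      rw [norm_mul]
      exact mul_le_mul (hM' t ht) (hVv t ht) (norm_nonneg _) hM'0
    rw [abs_of_nonneg (sub_nonneg.2 hab)] at b3
    have := norm_add_le ((∫ t in a..b, u t * (g t - h t)) - u b * (v b - V b))
      (∫ t in a..b, u' t * (v t - V t))
    have := norm_sub_le (∫ t in a..b, u t * (g t - h t)) (u b * (v b - V b))
    linarith
  rw [← sub_eq_zero, ← norm_le_zero_iff]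
  set K := 2 * M + M' * (b - a)
  have hK : 0 ≤ K := by have := sub_nonneg.2 hab; positivity
  refine le_of_forall_pos_le_add fun ε hε => ?_
  refine (key (ε / (K + 1)) (by positivity)).trans ?_
  rw [zero_add, mul_div_assoc', div_le_iff₀ (by positivity)]
  nlinarith

lemma rl_aux {a b : ℝ} (hab : a ≤ b) {f : ℝ → ℂ}
    (hf : IntervalIntegrable f MeasureTheory.volume a b) {ε : ℝ} (hε : 0 < ε) :
    ∃ R : ℝ, ∀ w : ℂ, R ≤ ‖w‖ →
      ‖∫ t in a..b, Complex.cos (2 * w * ((t - a : ℝ) : ℂ)) * f t‖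
        ≤ ε * Real.exp (2 * |w.im| * (b - a)) := by
  obtain ⟨h, hh, hfh⟩ := approx_aux hab hf (half_pos hε)
  have hhc := hh.continuous
  have hdc : Continuous (deriv h) := hh.continuous_deriv le_rfl
  set N := ∫ t in a..b, ‖deriv h t‖
  have hN : 0 ≤ N := intervalIntegral.integral_nonneg hab fun t _ => norm_nonneg _
  refine ⟨(‖h b‖ + N) / ε + 1, fun w hw => ?_⟩
  have hwpos : 0 < ‖w‖ := lt_of_lt_of_le (by positivity) hw
  have hw0 : w ≠ 0 := norm_pos_iff.1 hwpos
  set E := Real.exp (2 * |w.im| * (b - a))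
  have hE : 0 < E := Real.exp_pos _
  have him : ∀ t ∈ Set.Icc a b, Real.exp |(2 * w * ((t - a : ℝ) : ℂ)).im| ≤ E := by
    intro t ht
    apply Real.exp_le_exp.2
    rw [Complex.im_mul_ofReal, abs_mul, abs_of_nonneg (sub_nonneg.2 ht.1)]
    have : (2 * w).im = 2 * w.im := by simp
    rw [this, abs_mul, abs_two]
    have := ht.2
    gcongr
  have hcos : ∀ t ∈ Set.Icc a b, ‖Complex.cos (2 * w * ((t - a : ℝ) : ℂ))‖ ≤ E :=
    fun t ht => (norm_cos_le_aux _).trans (him t ht)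
  have hsin : ∀ t ∈ Set.Icc a b, ‖Complex.sin (2 * w * ((t - a : ℝ) : ℂ)) / (2 * w)‖
      ≤ E / (2 * ‖w‖) := by
    intro t ht
    rw [norm_div, norm_mul, show ‖(2:ℂ)‖ = 2 by simp]
    have := (norm_sin_le_aux _).trans (him t ht)
    gcongr
  have hder : ∀ t : ℝ, HasDerivAt (fun t : ℝ => Complex.sin (2 * w * ((t - a : ℝ) : ℂ)) / (2 * w))
      (Complex.cos (2 * w * ((t - a : ℝ) : ℂ))) t := by
    intro t
    have h1 : HasDerivAt (fun t : ℝ => 2 * w * ((t - a : ℝ) : ℂ)) (2 * w) t := by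
      simpa using (((hasDerivAt_id t).sub_const a).ofReal_comp).const_mul (2 * w)
    have h2 := ((Complex.hasDerivAt_sin (2 * w * ((t - a : ℝ) : ℂ))).comp t h1).div_const (2 * w)
    rw [mul_div_cancel_right₀ _ (mul_ne_zero two_ne_zero hw0)] at h2
    exact h2
  have hcc : Continuous (fun t : ℝ => Complex.cos (2 * w * ((t - a : ℝ) : ℂ))) := by fun_prop
  have e1 : ∫ t in a..b, Complex.cos (2 * w * ((t - a : ℝ) : ℂ)) * h t =
      Complex.sin (2 * w * ((b - a : ℝ) : ℂ)) / (2 * w) * h b -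
      ∫ t in a..b, Complex.sin (2 * w * ((t - a : ℝ) : ℂ)) / (2 * w) * deriv h t := by
    have := intervalIntegral.integral_mul_deriv_eq_deriv_mul (a := a) (b := b)
      (fun t _ => hder t) (fun t _ => (hh.differentiable (by simp)).differentiableAt.hasDerivAt)
      (hcc.intervalIntegrable a b) (hdc.intervalIntegrable a b)
    rw [this]; simp
  have hhi := hhc.intervalIntegrable (μ := MeasureTheory.volume) a b
  have e2 : ∫ t in a..b, Complex.cos (2 * w * ((t - a : ℝ) : ℂ)) * f t =
      (∫ t in a..b, Complex.cos (2 * w * ((t - a : ℝ) : ℂ)) * (f t - h t)) +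
      ∫ t in a..b, Complex.cos (2 * w * ((t - a : ℝ) : ℂ)) * h t := by
    simp only [mul_sub]
    rw [intervalIntegral.integral_sub (hf.continuousOn_mul hcc.continuousOn)
      (hhi.continuousOn_mul hcc.continuousOn)]
    ring
  have b1 : ‖∫ t in a..b, Complex.cos (2 * w * ((t - a : ℝ) : ℂ)) * (f t - h t)‖ ≤ E * (ε / 2) :=
    (bound_aux hab hcos (hf.sub hhi)).trans (mul_le_mul_of_nonneg_left hfh hE.le)
  have b2 : ‖∫ t in a..b, Complex.sin (2 * w * ((t - a : ℝ) : ℂ)) / (2 * w) * deriv h t‖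
      ≤ E / (2 * ‖w‖) * N := bound_aux hab hsin (hdc.intervalIntegrable a b)
  have b3 : ‖Complex.sin (2 * w * ((b - a : ℝ) : ℂ)) / (2 * w) * h b‖ ≤ E / (2 * ‖w‖) * ‖h b‖ := by
    rw [norm_mul]
    exact mul_le_mul_of_nonneg_right (hsin b ⟨hab, le_rfl⟩) (norm_nonneg _)
  have b4 : E / (2 * ‖w‖) * (‖h b‖ + N) ≤ E * (ε / 2) := by
    have : ‖h b‖ + N ≤ ε * ‖w‖ := by
      have : (‖h b‖ + N) / ε ≤ ‖w‖ := by linarith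
      rw [div_le_iff₀ hε] at this; linarith
    calc E / (2 * ‖w‖) * (‖h b‖ + N) ≤ E / (2 * ‖w‖) * (ε * ‖w‖) := by gcongr
      _ = E * (ε / 2) := by field_simp
  rw [e2, e1]
  refine (norm_add_le _ _).trans ?_
  have := norm_sub_le (Complex.sin (2 * w * ((b - a : ℝ) : ℂ)) / (2 * w) * h b)
    (∫ t in a..b, Complex.sin (2 * w * ((t - a : ℝ) : ℂ)) / (2 * w) * deriv h t)
  linarith

/-- Variation of constants. -/
lemma voc_aux {r x : ℝ} (hrx : r ≤ x) {q y y' : ℝ → ℂ} {w : ℂ} (hw : w ≠ 0)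
    (hq : IntervalIntegrable q MeasureTheory.volume r x)
    (hy0 : y r = 0) (hy1 : y' r = 1)
    (hyd : ∀ t ∈ Set.Icc r x, HasDerivAt y (y' t) t)
    (hyint : ∀ t ∈ Set.Icc r x, y' t = 1 + ∫ s in r..t, (q s - w ^ 2) * y s) :
    y x = Complex.sin (w * ((x - r : ℝ) : ℂ)) / w +
      ∫ t in r..x, (Complex.sin (w * ((x - t : ℝ) : ℂ)) / w * y t) * q t := by
  have huI : Set.uIcc r x = Set.Icc r x := Set.uIcc_of_le hrx
  have hyc : ContinuousOn y (Set.Icc r x) :=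
    fun t ht => (hyd t ht).continuousAt.continuousWithinAt
  have hlin : ∀ t : ℝ, HasDerivAt (fun t : ℝ => w * ((x - t : ℝ) : ℂ)) (-w) t := by
    intro t
    simpa using (((hasDerivAt_id t).const_sub x).ofReal_comp).const_mul w
  have hU : ∀ t : ℝ, HasDerivAt (fun t : ℝ => Complex.sin (w * ((x - t : ℝ) : ℂ)) / w)
      (-Complex.cos (w * ((x - t : ℝ) : ℂ))) t := by
    intro t
    have h2 := ((Complex.hasDerivAt_sin (w * ((x - t : ℝ) : ℂ))).comp t (hlin t)).div_const w
    rw [mul_neg, neg_div, mul_div_cancel_right₀ _ hw] at h2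
    exact h2
  have hU' : ∀ t : ℝ, HasDerivAt (fun t : ℝ => -Complex.cos (w * ((x - t : ℝ) : ℂ)))
      (-(w ^ 2) * (Complex.sin (w * ((x - t : ℝ) : ℂ)) / w)) t := by
    intro t
    have h2 := ((Complex.hasDerivAt_cos (w * ((x - t : ℝ) : ℂ))).comp t (hlin t)).neg
    have h3 : -(w ^ 2) * (Complex.sin (w * ((x - t : ℝ) : ℂ)) / w) =
        -(-Complex.sin (w * ((x - t : ℝ) : ℂ)) * -w) := by
      field_simp
    rw [h3]
    exact h2
  have hUc : Continuous (fun t : ℝ => Complex.sin (w * ((x - t : ℝ) : ℂ)) / w) := by fun_prop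
  have hU'c : Continuous (fun t : ℝ => -Complex.cos (w * ((x - t : ℝ) : ℂ))) := by fun_prop
  have hgi : IntervalIntegrable (fun s => (q s - w ^ 2) * y s) MeasureTheory.volume r x :=
    (hq.sub intervalIntegrable_const).mul_continuousOn (by rwa [huI])
  have hy'c : ContinuousOn y' (Set.Icc r x) := by
    have : ContinuousOn (fun x => 1 + ∫ s in r..x, (q s - w ^ 2) * y s) (Set.Icc r x) := by
      refine continuousOn_const.add ?_
      have := intervalIntegral.continuousOn_primitive_interval' hgi (a := r) (by simp)
      rwa [huI] at this
    exact this.congr hyint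
  have e1 := ibp_aux hrx 1 (fun t _ => hU t) hU'c.continuousOn hgi hyint
  have e2 := intervalIntegral.integral_mul_deriv_eq_deriv_mul (a := r) (b := x)
    (fun t _ => hU' t) (by rwa [huI]) ((hUc.const_mul (-(w ^ 2))).intervalIntegrable r x)
    (ContinuousOn.intervalIntegrable (by rwa [huI]))
  rw [e2] at e1
  have i1 : IntervalIntegrable (fun t => (Complex.sin (w * ((x - t : ℝ) : ℂ)) / w * y t) * q t)
      MeasureTheory.volume r x :=
    hq.continuousOn_mul (by rw [huI]; exact hUc.continuousOn.mul hyc)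
  have i2 : IntervalIntegrable
      (fun t => -(w ^ 2) * (Complex.sin (w * ((x - t : ℝ) : ℂ)) / w) * y t)
      MeasureTheory.volume r x :=
    ContinuousOn.intervalIntegrable
      (by rw [huI]; exact (hUc.const_mul (-(w ^ 2))).continuousOn.mul hyc)
  have e3 : ∫ t in r..x, Complex.sin (w * ((x - t : ℝ) : ℂ)) / w * ((q t - w ^ 2) * y t) =
      (∫ t in r..x, (Complex.sin (w * ((x - t : ℝ) : ℂ)) / w * y t) * q t) +
      ∫ t in r..x, -(w ^ 2) * (Complex.sin (w * ((x - t : ℝ) : ℂ)) / w) * y t := by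
    rw [← intervalIntegral.integral_add i1 i2]
    congr 1
    ext t
    ring
  rw [e3] at e1
  simp only [sub_self, Complex.ofReal_zero, mul_zero, Complex.sin_zero, zero_div, zero_mul,
    Complex.cos_zero, hy0, hy1, mul_one, zero_sub, sub_zero] at e1
  linear_combination -e1

lemma est_aux {r x₀ : ℝ} (hrx : r ≤ x₀) {q y y' : ℝ → ℂ} {w : ℂ} (hw : w ≠ 0)
    (hq : IntervalIntegrable q MeasureTheory.volume r x₀)
    (hy0 : y r = 0) (hy1 : y' r = 1)
    (hyd : ∀ t ∈ Set.Icc r x₀, HasDerivAt y (y' t) t)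
    (hyint : ∀ t ∈ Set.Icc r x₀, y' t = 1 + ∫ s in r..t, (q s - w ^ 2) * y s)
    {N : ℝ} (hN : ∫ t in r..x₀, ‖q t‖ ≤ N) (hNw : 2 * N ≤ ‖w‖) :
    ∀ x ∈ Set.Icc r x₀, ‖y x‖ ≤ 2 / ‖w‖ * Real.exp (|w.im| * (x - r)) ∧
      ‖y x - Complex.sin (w * ((x - r : ℝ) : ℂ)) / w‖
        ≤ 2 * N / ‖w‖ ^ 2 * Real.exp (|w.im| * (x - r)) := by
  have hwpos : 0 < ‖w‖ := norm_pos_iff.2 hw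
  have hN0 : 0 ≤ N :=
    (intervalIntegral.integral_nonneg hrx fun t _ => norm_nonneg _).trans hN
  have hyc : ContinuousOn y (Set.Icc r x₀) :=
    fun t ht => (hyd t ht).continuousAt.continuousWithinAt
  have hsin : ∀ s : ℝ, 0 ≤ s → ‖Complex.sin (w * (s : ℂ)) / w‖ ≤ Real.exp (|w.im| * s) / ‖w‖ := by
    intro s hs
    rw [norm_div]
    have := norm_sin_le_aux (w * (s : ℂ))
    rw [Complex.im_mul_ofReal, abs_mul, abs_of_nonneg hs] at this
    gcongr
  have gen : ∀ M : ℝ, 0 ≤ M → (∀ t ∈ Set.Icc r x₀, ‖y t‖ ≤ M * Real.exp (|w.im| * (t - r))) →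
      ∀ x ∈ Set.Icc r x₀, ‖y x - Complex.sin (w * ((x - r : ℝ) : ℂ)) / w‖
        ≤ M * N / ‖w‖ * Real.exp (|w.im| * (x - r)) := by
    intro M hM0 hM x hx
    have hsub : Set.Icc r x ⊆ Set.Icc r x₀ := Set.Icc_subset_Icc_right hx.2
    have hqx : IntervalIntegrable q MeasureTheory.volume r x :=
      hq.mono_set (by rw [Set.uIcc_of_le hrx, Set.uIcc_of_le hx.1]; exact hsub)
    rw [voc_aux hx.1 hw hqx hy0 hy1 (fun t ht => hyd t (hsub ht))
      (fun t ht => hyint t (hsub ht)), add_sub_cancel_left]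
    have hb := bound_aux hx.1
      (u := fun t => Complex.sin (w * ((x - t : ℝ) : ℂ)) / w * y t)
      (M := M / ‖w‖ * Real.exp (|w.im| * (x - r))) ?_ hqx
    · refine hb.trans ?_
      have h2 : ∫ t in r..x, ‖q t‖ ≤ N := by
        refine le_trans ?_ hN
        refine intervalIntegral.integral_mono_interval le_rfl hx.1 hx.2 ?_ hq.norm
        exact Filter.Eventually.of_forall fun t => norm_nonneg _
      calc _ ≤ M / ‖w‖ * Real.exp (|w.im| * (x - r)) * N := by gcongr
        _ = _ := by ring
    · intro t ht
      rw [norm_mul]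
      calc _ ≤ Real.exp (|w.im| * (x - t)) / ‖w‖ * (M * Real.exp (|w.im| * (t - r))) :=
            mul_le_mul (hsin _ (sub_nonneg.2 ht.2)) (hM t (hsub ht)) (norm_nonneg _)
              (by positivity)
        _ = M / ‖w‖ * (Real.exp (|w.im| * (x - t)) * Real.exp (|w.im| * (t - r))) := by ring
        _ = _ := by rw [← Real.exp_add]; ring_nf
  obtain ⟨t₀, ht₀, hmax⟩ := isCompact_Icc.exists_isMaxOn (Set.nonempty_Icc.2 hrx)
    (f := fun t => ‖y t‖ * Real.exp (-(|w.im| * (t - r))))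
    (hyc.norm.mul (by fun_prop))
  set M := ‖y t₀‖ * Real.exp (-(|w.im| * (t₀ - r))) with hMdef
  have hM0 : 0 ≤ M := by positivity
  have hM : ∀ t ∈ Set.Icc r x₀, ‖y t‖ ≤ M * Real.exp (|w.im| * (t - r)) := by
    intro t ht
    have h1 : ‖y t‖ * Real.exp (-(|w.im| * (t - r))) ≤ M := hmax ht
    rwa [Real.exp_neg, ← div_eq_mul_inv, div_le_iff₀ (Real.exp_pos _)] at h1
  have hM2 : M ≤ 2 / ‖w‖ := by
    have h1 := gen M hM0 hM t₀ ht₀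
    have h2 := hsin (t₀ - r) (sub_nonneg.2 ht₀.1)
    have h3 := norm_le_norm_sub_add (y t₀) (Complex.sin (w * ((t₀ - r : ℝ) : ℂ)) / w)
    have h4 : ‖y t₀‖ ≤ (M * N / ‖w‖ + 1 / ‖w‖) * Real.exp (|w.im| * (t₀ - r)) := by
      rw [add_mul, div_mul_eq_mul_div 1, one_mul]; linarith
    have h5 : M ≤ M * N / ‖w‖ + 1 / ‖w‖ := by
      rw [hMdef, Real.exp_neg, ← div_eq_mul_inv, div_le_iff₀ (Real.exp_pos _)]
      rwa [hMdef, Real.exp_neg, ← div_eq_mul_inv] at h4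
    rw [← add_div, le_div_iff₀ hwpos] at h5
    rw [le_div_iff₀ hwpos]
    nlinarith
  have hM3 : ∀ t ∈ Set.Icc r x₀, ‖y t‖ ≤ 2 / ‖w‖ * Real.exp (|w.im| * (t - r)) :=
    fun t ht => (hM t ht).trans (by gcongr)
  refine fun x hx => ⟨hM3 x hx, (gen (2 / ‖w‖) (by positivity) hM3 x hx).trans_eq ?_⟩
  congr 1
  field_simp

lemma wronskian_aux {r x₀ : ℝ} (hrx : r ≤ x₀) {q qt y y' z z' : ℝ → ℂ} {lam : ℂ}
    (hq : IntervalIntegrable q MeasureTheory.volume r x₀)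
    (hqt : IntervalIntegrable qt MeasureTheory.volume r x₀)
    (hy0 : y r = 0) (hz0 : z r = 0)
    (hyd : ∀ t ∈ Set.Icc r x₀, HasDerivAt y (y' t) t)
    (hzd : ∀ t ∈ Set.Icc r x₀, HasDerivAt z (z' t) t)
    (hyint : ∀ t ∈ Set.Icc r x₀, y' t = 1 + ∫ s in r..t, (q s - lam) * y s)
    (hzint : ∀ t ∈ Set.Icc r x₀, z' t = 1 + ∫ s in r..t, (qt s - lam) * z s) :
    y x₀ * z' x₀ - y' x₀ * z x₀ = ∫ t in r..x₀, (y t * z t) * (qt t - q t) := by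
  have huI : Set.uIcc r x₀ = Set.Icc r x₀ := Set.uIcc_of_le hrx
  have hyc : ContinuousOn y (Set.Icc r x₀) :=
    fun t ht => (hyd t ht).continuousAt.continuousWithinAt
  have hzc : ContinuousOn z (Set.Icc r x₀) :=
    fun t ht => (hzd t ht).continuousAt.continuousWithinAt
  have hgi : IntervalIntegrable (fun s => (q s - lam) * y s) MeasureTheory.volume r x₀ :=
    (hq.sub intervalIntegrable_const).mul_continuousOn (by rwa [huI])
  have hki : IntervalIntegrable (fun s => (qt s - lam) * z s) MeasureTheory.volume r x₀ :=
    (hqt.sub intervalIntegrable_const).mul_continuousOn (by rwa [huI])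
  have hy'c : ContinuousOn y' (Set.Icc r x₀) := by
    have : ContinuousOn (fun x => 1 + ∫ s in r..x, (q s - lam) * y s) (Set.Icc r x₀) := by
      refine continuousOn_const.add ?_
      have := intervalIntegral.continuousOn_primitive_interval' hgi (a := r) (by simp)
      rwa [huI] at this
    exact this.congr hyint
  have hz'c : ContinuousOn z' (Set.Icc r x₀) := by
    have : ContinuousOn (fun x => 1 + ∫ s in r..x, (qt s - lam) * z s) (Set.Icc r x₀) := by
      refine continuousOn_const.add ?_
      have := intervalIntegral.continuousOn_primitive_interval' hki (a := r) (by simp)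
      rwa [huI] at this
    exact this.congr hzint
  have e1 := ibp_aux hrx 1 hyd hy'c hki hzint
  have e2 := ibp_aux hrx 1 hzd hz'c hgi hyint
  have e3 : ∫ t in r..x₀, (y t * z t) * (qt t - q t) =
      (∫ t in r..x₀, y t * ((qt t - lam) * z t)) - ∫ t in r..x₀, z t * ((q t - lam) * y t) := by
    rw [← intervalIntegral.integral_sub (hki.continuousOn_mul (by rwa [huI]))
      (hgi.continuousOn_mul (by rwa [huI]))]
    congr 1
    ext t
    ring
  have e4 : ∫ t in r..x₀, z' t * y' t = ∫ t in r..x₀, y' t * z' t := by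
    simp only [mul_comm]
  rw [e3, e1, e2, e4, hy0, hz0]
  ring

/-- For `q, q̃ ∈ L¹[0,π]`, `r ∈ [0,π)`, `x₀ ∈ (r,π]`, let
`y_{2,r}(·,λ)`, `ỹ_{2,r}(·,λ)` solve `−y''+qy = λy`, resp. `−y''+q̃y = λy`
(Carathéodory/integral form) with `y(r)=0`, `y'(r)=1`. Then as `|λ| → ∞`,
`y ỹ' − y' ỹ` at `x₀` equals `(1/(2λ))∫_r^{x₀}(q̃−q) + o(exp(2|Im √λ|(x₀−r))/|λ|)`. -/
theorem stmt14 (q qt : ℝ → ℂ)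
    (hq : MeasureTheory.IntegrableOn q (Set.Icc 0 Real.pi))
    (hqt : MeasureTheory.IntegrableOn qt (Set.Icc 0 Real.pi))
    (r x₀ : ℝ) (hr : 0 ≤ r) (hrx : r < x₀) (hx₀ : x₀ ≤ Real.pi)
    (y y' z z' : ℂ → ℝ → ℂ)
    (hy0 : ∀ lam : ℂ, y lam r = 0) (hy1 : ∀ lam : ℂ, y' lam r = 1)
    (hz0 : ∀ lam : ℂ, z lam r = 0) (hz1 : ∀ lam : ℂ, z' lam r = 1)
    (hyd : ∀ lam : ℂ, ∀ x ∈ Set.Icc r x₀, HasDerivAt (y lam) (y' lam x) x)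
    (hzd : ∀ lam : ℂ, ∀ x ∈ Set.Icc r x₀, HasDerivAt (z lam) (z' lam x) x)
    (hyint : ∀ lam : ℂ, ∀ x ∈ Set.Icc r x₀,
      y' lam x = 1 + ∫ t in r..x, (q t - lam) * y lam t)
    (hzint : ∀ lam : ℂ, ∀ x ∈ Set.Icc r x₀,
      z' lam x = 1 + ∫ t in r..x, (qt t - lam) * z lam t) :
    ∀ ε > (0:ℝ), ∃ R : ℝ, ∀ lam w : ℂ, w ^ 2 = lam → R ≤ ‖lam‖ →
      ‖(y lam x₀ * z' lam x₀ - y' lam x₀ * z lam x₀)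
          - (1 / (2 * lam)) * ∫ t in r..x₀, (qt t - q t)‖
        ≤ ε * Real.exp (2 * |w.im| * (x₀ - r)) / ‖lam‖ := by
  intro ε hε
  have hle := hrx.le
  have huI : Set.uIcc r x₀ = Set.Icc r x₀ := Set.uIcc_of_le hle
  have hI : ∀ f : ℝ → ℂ, MeasureTheory.IntegrableOn f (Set.Icc 0 Real.pi) →
      IntervalIntegrable f MeasureTheory.volume r x₀ := fun f hf =>
    (intervalIntegrable_iff_integrableOn_Icc_of_le hle).2
      (hf.mono_set (Set.Icc_subset_Icc hr hx₀))
  have hqi := hI q hq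
  have hqti := hI qt hqt
  have hpi : IntervalIntegrable (fun t => qt t - q t) MeasureTheory.volume r x₀ := hqti.sub hqi
  set N := (∫ t in r..x₀, ‖q t‖) + ∫ t in r..x₀, ‖qt t‖ with hNdef
  have hn1 : 0 ≤ ∫ t in r..x₀, ‖q t‖ :=
    intervalIntegral.integral_nonneg hle fun t _ => norm_nonneg _
  have hn2 : 0 ≤ ∫ t in r..x₀, ‖qt t‖ :=
    intervalIntegral.integral_nonneg hle fun t _ => norm_nonneg _
  have hN0 : 0 ≤ N := add_nonneg hn1 hn2
  set K := ∫ t in r..x₀, ‖qt t - q t‖ with hKdef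
  have hK0 : 0 ≤ K := intervalIntegral.integral_nonneg hle fun t _ => norm_nonneg _
  obtain ⟨R₁, hR₁⟩ := rl_aux hle hpi hε
  set R₀ := max 1 (max R₁ (max (2 * N) (12 * K * N / ε)))
  have hR₀ : 1 ≤ R₀ := le_max_left _ _
  refine ⟨R₀ ^ 2, fun lam w hwl hR => ?_⟩
  subst hwl
  rw [norm_pow] at hR
  have hRw : R₀ ≤ ‖w‖ := (sq_le_sq₀ (by linarith) (norm_nonneg _)).1 hR
  have hwpos : 0 < ‖w‖ := by linarith
  have hw : w ≠ 0 := norm_pos_iff.1 hwpos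
  have hw1 : R₁ ≤ ‖w‖ := ((le_max_left _ _).trans (le_max_right _ _)).trans hRw
  have hw2 : 2 * N ≤ ‖w‖ :=
    (((le_max_left _ _).trans (le_max_right _ _)).trans (le_max_right _ _)).trans hRw
  have hw3 : 12 * K * N / ε ≤ ‖w‖ :=
    (((le_max_right _ _).trans (le_max_right _ _)).trans (le_max_right _ _)).trans hRw
  have estY := est_aux hle hw hqi (hy0 _) (hy1 _) (hyd (w ^ 2)) (hyint (w ^ 2))
    (N := N) (by linarith) hw2
  have estZ := est_aux hle hw hqti (hz0 _) (hz1 _) (hzd (w ^ 2)) (hzint (w ^ 2))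
    (N := N) (by linarith) hw2
  have hW := wronskian_aux hle hqi hqti (hy0 _) (hz0 _) (hyd (w ^ 2)) (hzd (w ^ 2))
    (hyint (w ^ 2)) (hzint (w ^ 2))
  set S : ℝ → ℂ := fun t => Complex.sin (w * ((t - r : ℝ) : ℂ)) / w with hS
  set E := Real.exp (2 * |w.im| * (x₀ - r)) with hE
  have hSc : Continuous S := by simp only [hS]; fun_prop
  have hyc : ContinuousOn (y (w ^ 2)) (Set.Icc r x₀) :=
    fun t ht => (hyd _ t ht).continuousAt.continuousWithinAt
  have hzc : ContinuousOn (z (w ^ 2)) (Set.Icc r x₀) :=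
    fun t ht => (hzd _ t ht).continuousAt.continuousWithinAt
  have hSb : ∀ t ∈ Set.Icc r x₀, ‖S t‖ ≤ 1 / ‖w‖ * Real.exp (|w.im| * (t - r)) := by
    intro t ht
    have := norm_sin_le_aux (w * ((t - r : ℝ) : ℂ))
    rw [Complex.im_mul_ofReal, abs_mul, abs_of_nonneg (sub_nonneg.2 ht.1)] at this
    rw [hS, norm_div, div_mul_eq_mul_div, one_mul]
    gcongr
  have hdiff : ∀ t ∈ Set.Icc r x₀,
      ‖y (w ^ 2) t * z (w ^ 2) t - S t * S t‖ ≤ 6 * N / ‖w‖ ^ 3 * E := by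
    intro t ht
    set e := Real.exp (|w.im| * (t - r)) with he
    have hepos : 0 < e := Real.exp_pos _
    have hee : e * e ≤ E := by
      rw [he, hE, ← Real.exp_add]
      apply Real.exp_le_exp.2
      have := mul_le_mul_of_nonneg_left (sub_le_sub_right ht.2 r) (abs_nonneg w.im)
      linarith
    have h1 : y (w ^ 2) t * z (w ^ 2) t - S t * S t =
        (y (w ^ 2) t - S t) * z (w ^ 2) t + S t * (z (w ^ 2) t - S t) := by ring
    rw [h1]
    refine (norm_add_le _ _).trans ?_
    rw [norm_mul, norm_mul]
    calc _ ≤ (2 * N / ‖w‖ ^ 2 * e) * (2 / ‖w‖ * e) + (1 / ‖w‖ * e) * (2 * N / ‖w‖ ^ 2 * e) := by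
          refine add_le_add
            (mul_le_mul (estY t ht).2 (estZ t ht).1 (norm_nonneg _) (by positivity))
            (mul_le_mul (hSb t ht) (estZ t ht).2 (norm_nonneg _) (by positivity))
      _ = 6 * N / ‖w‖ ^ 3 * (e * e) := by field_simp; ring
      _ ≤ _ := by gcongr
  have hcc : Continuous (fun t : ℝ => Complex.cos (2 * w * ((t - r : ℝ) : ℂ))) := by fun_prop
  have i1 : IntervalIntegrable (fun t => (y (w ^ 2) t * z (w ^ 2) t) * (qt t - q t))
      MeasureTheory.volume r x₀ := hpi.continuousOn_mul (by rw [huI]; exact hyc.mul hzc)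
  have i2 : IntervalIntegrable (fun t => (S t * S t) * (qt t - q t))
      MeasureTheory.volume r x₀ := hpi.continuousOn_mul (hSc.mul hSc).continuousOn
  have i3 : IntervalIntegrable
      (fun t => Complex.cos (2 * w * ((t - r : ℝ) : ℂ)) * (qt t - q t))
      MeasureTheory.volume r x₀ := hpi.continuousOn_mul hcc.continuousOn
  have e1 : ∫ t in r..x₀, (S t * S t) * (qt t - q t) =
      1 / (2 * w ^ 2) * (∫ t in r..x₀, (qt t - q t)) - 1 / (2 * w ^ 2) *
        ∫ t in r..x₀, Complex.cos (2 * w * ((t - r : ℝ) : ℂ)) * (qt t - q t) := by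
    rw [← mul_sub, ← intervalIntegral.integral_sub hpi i3, ← intervalIntegral.integral_const_mul]
    congr 1
    ext t
    have : Complex.cos (2 * w * ((t - r : ℝ) : ℂ)) =
        1 - 2 * Complex.sin (w * ((t - r : ℝ) : ℂ)) ^ 2 := by
      rw [mul_assoc, Complex.cos_two_mul, Complex.cos_sq']; ring
    rw [this]
    simp only [hS]
    field_simp
    ring
  have e2 : ∫ t in r..x₀, (y (w ^ 2) t * z (w ^ 2) t - S t * S t) * (qt t - q t) =
      (∫ t in r..x₀, (y (w ^ 2) t * z (w ^ 2) t) * (qt t - q t)) -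
        ∫ t in r..x₀, (S t * S t) * (qt t - q t) := by
    rw [← intervalIntegral.integral_sub i1 i2]
    congr 1
    ext t
    ring
  have e3 : (y (w ^ 2) x₀ * z' (w ^ 2) x₀ - y' (w ^ 2) x₀ * z (w ^ 2) x₀)
          - (1 / (2 * w ^ 2)) * ∫ t in r..x₀, (qt t - q t) =
      (∫ t in r..x₀, (y (w ^ 2) t * z (w ^ 2) t - S t * S t) * (qt t - q t)) -
      1 / (2 * w ^ 2) *
        ∫ t in r..x₀, Complex.cos (2 * w * ((t - r : ℝ) : ℂ)) * (qt t - q t) := by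
    rw [hW, e2, e1]; ring
  rw [e3]
  have b1 := bound_aux hle hdiff hpi
  have b2 := hR₁ w hw1
  have hEpos : 0 < E := Real.exp_pos _
  have b3 : 6 * N / ‖w‖ ^ 3 * E * K ≤ ε / 2 * E / ‖w‖ ^ 2 := by
    have h1 : 12 * K * N ≤ ε * ‖w‖ := by
      rw [div_le_iff₀ hε] at hw3; linarith
    calc 6 * N / ‖w‖ ^ 3 * E * K = (12 * K * N) * (E / (2 * ‖w‖ ^ 3)) := by ring
      _ ≤ (ε * ‖w‖) * (E / (2 * ‖w‖ ^ 3)) := by gcongr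
      _ = _ := by field_simp
  have b4 : ‖1 / (2 * w ^ 2) *
        ∫ t in r..x₀, Complex.cos (2 * w * ((t - r : ℝ) : ℂ)) * (qt t - q t)‖
      ≤ ε / 2 * E / ‖w‖ ^ 2 := by
    rw [norm_mul, norm_div, norm_mul, norm_pow, norm_one, show ‖(2:ℂ)‖ = 2 by simp]
    calc _ ≤ 1 / (2 * ‖w‖ ^ 2) * (ε * E) := by gcongr
      _ = _ := by ring
  rw [norm_pow]
  refine (norm_sub_le _ _).trans ?_
  have : ε * E / ‖w‖ ^ 2 = ε / 2 * E / ‖w‖ ^ 2 + ε / 2 * E / ‖w‖ ^ 2 := by ring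
  rw [this]
  exact add_le_add (b1.trans b3) b4
end
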